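/- arXiv:2009.11500 — 3 statements merged into one kernel-verified Lean document; each statement's English description precedes it below -/
import Mathlib

section
/- Let F : E × ℝ → E (E a real Banach space) be continuous and uniformly Lipschitz in its first argument with constant L > 0 on [a, b], and let Φ : [a, b] → E be a twice continuously differentiable solution of Φ'(s) = F(Φ(s), s) with bounded second derivative on [a, b]. For each integer M ≥ 1 let Φ_M^{end} denote the final iterate of the M-stage recursive explicit Euler scheme with uniform step h = (b − a)/M started from Φ(a). Then Φ_M^{end} converges to the exact value Φ(b) as M → ∞. -/
/-- Convergence of the recursive explicit Euler scheme: if `F` is continuous and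
uniformly Lipschitz in its first argument on `[a, b]`, and `Φ` is a `C²` solution of
`Φ' = F(Φ, ·)` with bounded second derivative on `[a, b]`, then the final iterate
`P M M` of the `M`-stage explicit Euler scheme with step `h = (b − a)/M` started
from `Φ(a)` converges to `Φ(b)` as `M → ∞`. -/
theorem recursive_euler_convergence
    {E : Type*} [NormedAddCommGroup E] [NormedSpace ℝ E] [CompleteSpace E]
    (F : E × ℝ → E) (Φ : ℝ → E) (a b L : ℝ) (hab : a ≤ b)
    (hL : 0 < L)
    (hFcont : Continuous F)
    (hFlip : ∀ x y : E, ∀ s ∈ Set.Icc a b, ‖F (x, s) - F (y, s)‖ ≤ L * ‖x - y‖)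
    (hΦ : ContDiffOn ℝ 2 Φ (Set.Icc a b))
    (hODE : ∀ s ∈ Set.Icc a b, HasDerivAt Φ (F (Φ s, s)) s)
    (hM₂ : ∃ M₂ : ℝ, ∀ s ∈ Set.Icc a b, ‖iteratedDerivWithin 2 Φ (Set.Icc a b) s‖ ≤ M₂)
    (P : ℕ → ℕ → E)
    (hP0 : ∀ M : ℕ, 1 ≤ M → P M 0 = Φ a)
    (hPrec : ∀ M : ℕ, 1 ≤ M → ∀ s < M,
      P M (s + 1) = P M s + ((b - a) / M) • F (P M s, a + s * ((b - a) / M))) :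
    Filter.Tendsto (fun M : ℕ => P M M) Filter.atTop (nhds (Φ b)) := by
  have hcont : ContinuousOn (fun s => F (Φ s, s)) (Set.Icc a b) :=
    hFcont.comp_continuousOn
      (ContinuousOn.prodMk (fun s hs => (hODE s hs).continuousAt.continuousWithinAt) continuousOn_id)
  have huc := isCompact_Icc.uniformContinuousOn_of_continuous hcont
  rw [Metric.uniformContinuousOn_iff] at huc
  rw [Metric.tendsto_atTop]
  intro ε hε
  have hX : 0 < Real.exp (L * (b - a)) := Real.exp_pos _
  obtain ⟨c, hc⟩ : ∃ c : ℝ, c = ε * L / Real.exp (L * (b - a)) / 2 := ⟨_, rfl⟩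
  have hc0 : 0 < c := by rw [hc]; positivity
  obtain ⟨δ, hδ, hδ'⟩ := huc c hc0
  obtain ⟨N, hN⟩ := exists_nat_gt ((b - a) / δ)
  refine ⟨N + 1, fun M hM => ?_⟩
  have hM1 : 1 ≤ M := by omega
  have hMpos : (0 : ℝ) < M := by exact_mod_cast hM1
  obtain ⟨h, hh⟩ : ∃ h : ℝ, h = (b - a) / M := ⟨_, rfl⟩
  have hh0 : 0 ≤ h := by rw [hh]; exact div_nonneg (by linarith) hMpos.le
  have hMh : (M : ℝ) * h = b - a := by rw [hh]; field_simp
  have hhδ : h < δ := by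
    rw [hh, div_lt_iff₀ hMpos]
    rw [div_lt_iff₀ hδ] at hN
    have : (N : ℝ) ≤ M := by exact_mod_cast (by omega : N ≤ M)
    nlinarith
  have key : ∀ s : ℕ, s ≤ M → ‖P M s - Φ (a + s * h)‖ ≤ c / L * ((1 + L * h) ^ s - 1) := by
    intro s
    induction s with
    | zero => intro _; simp [hP0 M hM1]
    | succ s ih =>
      intro hs
      have ih := ih (by omega)
      have hsM : ((s : ℝ) + 1) ≤ M := by exact_mod_cast hs
      have hs0 : (0 : ℝ) ≤ s := Nat.cast_nonneg s
      have hrec := hPrec M hM1 s (by omega)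
      rw [← hh] at hrec
      obtain ⟨t, ht⟩ : ∃ t : ℝ, t = a + s * h := ⟨_, rfl⟩
      have hta : a ≤ t := by rw [ht]; nlinarith
      have htb : t + h ≤ b := by rw [ht]; nlinarith
      have ht1 : a + ((s + 1 : ℕ) : ℝ) * h = t + h := by rw [ht]; push_cast; ring
      rw [ht1, hrec]
      rw [← ht] at ih ⊢
      have htm : t ∈ Set.Icc a b := ⟨hta, by linarith⟩
      have loc : ‖(Φ (t + h) - (t + h) • F (Φ t, t)) - (Φ t - t • F (Φ t, t))‖ ≤ c * ‖(t + h) - t‖ := by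
        refine Convex.norm_image_sub_le_of_norm_hasDerivWithin_le
          (f := fun u => Φ u - u • F (Φ t, t)) (f' := fun u => F (Φ u, u) - F (Φ t, t))
          (s := Set.Icc t (t + h)) ?_ ?_ (convex_Icc _ _) ⟨le_refl _, by linarith⟩
          ⟨by linarith, le_refl _⟩
        · intro u hu
          have := (hODE u ⟨by linarith [hu.1], by linarith [hu.2]⟩).sub
            ((hasDerivAt_id u).smul_const (F (Φ t, t)))
          rw [one_smul] at this
          exact this.hasDerivWithinAt
        · intro u hu
          have := hδ' u ⟨by linarith [hu.1], by linarith [hu.2]⟩ t htm (by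
            rw [Real.dist_eq, abs_of_nonneg (by linarith [hu.1])]; linarith [hu.2])
          rw [dist_eq_norm] at this
          exact this.le
      have e1 : ‖(t + h) - t‖ = h := by
        rw [add_sub_cancel_left, Real.norm_eq_abs, abs_of_nonneg hh0]
      rw [e1] at loc
      have e2 : P M s + h • F (P M s, t) - Φ (t + h) =
          (P M s - Φ t) + h • (F (P M s, t) - F (Φ t, t)) -
          ((Φ (t + h) - (t + h) • F (Φ t, t)) - (Φ t - t • F (Φ t, t))) := by
        module
      have hl := hFlip (P M s) (Φ t) t htm
      have e3 : ‖h • (F (P M s, t) - F (Φ t, t))‖ ≤ h * (L * ‖P M s - Φ t‖) := by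
        rw [norm_smul, Real.norm_eq_abs, abs_of_nonneg hh0]
        exact mul_le_mul_of_nonneg_left hl hh0
      calc _ ≤ ‖P M s - Φ t‖ + h * (L * ‖P M s - Φ t‖) + c * h := by
            rw [e2]
            refine (norm_sub_le _ _).trans (add_le_add ((norm_add_le _ _).trans ?_) loc)
            linarith
        _ = (1 + L * h) * ‖P M s - Φ t‖ + c * h := by ring
        _ ≤ (1 + L * h) * (c / L * ((1 + L * h) ^ s - 1)) + c * h := by
            have : 0 ≤ 1 + L * h := by positivity
            gcongr
        _ = _ := by field_simp; ring
  have hfin := key M le_rfl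
  rw [hMh, add_sub_cancel] at hfin
  have hpow : (1 + L * h) ^ M ≤ Real.exp (L * (b - a)) := by
    have h1 : 1 + L * h ≤ Real.exp (L * h) := by linarith [Real.add_one_le_exp (L * h)]
    calc (1 + L * h) ^ M ≤ Real.exp (L * h) ^ M := by
          have : 0 ≤ 1 + L * h := by positivity
          gcongr
      _ = _ := by rw [← Real.exp_nat_mul, ← hMh]; congr 1; ring
  rw [dist_eq_norm]
  calc _ ≤ c / L * ((1 + L * h) ^ M - 1) := hfin
    _ ≤ c / L * Real.exp (L * (b - a)) := by
        have : 0 < c / L := by positivity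
        gcongr
        linarith
    _ = ε / 2 := by rw [hc]; field_simp
    _ < ε := by linarith
end

section
/- Let F : ℝⁿ × ℝ → ℝⁿ be four times continuously differentiable (ContDiff of order 4), and let Φ : ℝ → ℝⁿ solve Φ'(s) = F(Φ(s), s) on a neighborhood of t. Then there exist constants C > 0 and h₀ > 0 such that for all 0 < h ≤ h₀ the single classical four-stage Runge–Kutta step satisfies ‖Φ(t+h) − (Φ(t) + (h/6)·(K₁ + 2K₂ + 2K₃ + K₄))‖ ≤ C·h⁵, where K₁ = F(Φ(t), t), K₂ = F(Φ(t) + (h/2)·K₁, t + h/2), K₃ = F(Φ(t) + (h/2)·K₂, t + h/2), and K₄ = F(Φ(t) + h·K₃, t + h). That is, the local truncation error of the four-stage Runge–Kutta step is O(h⁵). -/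
open Asymptotics Filter Topology Set

set_option linter.unusedSectionVars false

namespace RK4Aux

variable {E G : Type*} [NormedAddCommGroup E] [NormedSpace ℝ E]
  [NormedAddCommGroup G] [NormedSpace ℝ G]

/-- `Ord k f` : `f h = O(h^k)` as `h → 0+`. -/
def Ord (k : ℕ) (f : ℝ → E) : Prop := f =O[𝓝[>] (0 : ℝ)] (fun h : ℝ => h ^ k)

theorem Ord.add {k : ℕ} {f g : ℝ → E} (hf : Ord k f) (hg : Ord k g) :
    Ord k (fun h => f h + g h) := IsBigO.add hf hg

theorem Ord.sub {k : ℕ} {f g : ℝ → E} (hf : Ord k f) (hg : Ord k g) :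
    Ord k (fun h => f h - g h) := IsBigO.sub hf hg

theorem Ord.smulc {k : ℕ} {f : ℝ → E} (c : ℝ) (hf : Ord k f) :
    Ord k (fun h => c • f h) := IsBigO.const_smul_left hf c

theorem Ord.hsmul {k : ℕ} {f : ℝ → E} (hf : Ord k f) :
    Ord (k + 1) (fun h => h • f h) := by
  have h1 : (fun h : ℝ => h) =O[𝓝[>] (0 : ℝ)] (fun h : ℝ => h) := isBigO_refl _ _
  have := h1.smul hf
  unfold Ord
  simpa [pow_succ, mul_comm] using this

theorem Ord.mono {k j : ℕ} (hjk : j ≤ k) {f : ℝ → E} (hf : Ord k f) : Ord j f := by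
  refine IsBigO.trans hf ?_
  refine IsBigO.of_bound' ?_
  filter_upwards [Ioo_mem_nhdsGT (show (0 : ℝ) < 1 by norm_num)] with x hx
  rw [norm_pow, norm_pow, Real.norm_eq_abs, abs_of_pos hx.1]
  exact pow_le_pow_of_le_one hx.1.le hx.2.le hjk

theorem Ord.mono' {k j : ℕ} {f : ℝ → E} (hf : Ord k f) (hjk : j ≤ k) : Ord j f := hf.mono hjk

theorem Ord.const (v : E) : Ord 0 (fun _ => v) := by
  unfold Ord; simpa using isBigO_const_const v (one_ne_zero (α := ℝ)) _

theorem Ord.pow (k : ℕ) (v : E) : Ord k (fun h => h ^ k • v) := by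
  induction k with
  | zero => simpa using Ord.const v
  | succ k ih => simpa [smul_smul, pow_succ, mul_comm] using ih.hsmul

theorem Ord.congr {k : ℕ} {f g : ℝ → E} (hf : Ord k f) (h : ∀ x, g x = f x) : Ord k g := by
  rwa [show g = f from funext h]

theorem Ord.bil {i j : ℕ} {A : ℝ → E →L[ℝ] G} {v : ℝ → E} (hA : Ord i A) (hv : Ord j v) :
    Ord (i + j) (fun h => A h (v h)) := by
  have h1 := (isBoundedBilinearMap_apply (𝕜 := ℝ) (E := E) (F := G)).isBigO_comp
    (g := A) (h := v) (l := 𝓝[>] (0 : ℝ))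
  refine h1.trans ?_
  have h2 := hA.norm_left.mul hv.norm_left
  simpa [pow_add] using h2

theorem Ord.half {k : ℕ} {f : ℝ → E} (hf : Ord k f) : Ord k (fun h => f (h / 2)) := by
  have ht : Tendsto (fun h : ℝ => h / 2) (𝓝[>] 0) (𝓝[>] 0) := by
    refine tendsto_nhdsWithin_iff.2 ⟨?_, ?_⟩
    · have : Tendsto (fun h : ℝ => h / 2) (𝓝 0) (𝓝 (0 / 2)) := tendsto_id.div_const 2
      rw [zero_div] at this
      exact this.mono_left nhdsWithin_le_nhds
    · filter_upwards [self_mem_nhdsWithin] with x hx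
      exact half_pos (mem_Ioi.1 hx)
  have h1 := IsBigO.comp_tendsto hf ht
  refine h1.trans ?_
  refine IsBigO.of_bound' ?_
  filter_upwards [self_mem_nhdsWithin] with x hx
  have hx : 0 < x := hx
  simp only [Function.comp, norm_pow, Real.norm_eq_abs]
  rw [abs_of_pos hx, abs_of_pos (half_pos hx)]
  gcongr
  linarith

theorem Ord.tendsto {k : ℕ} (hk : 1 ≤ k) {f : ℝ → E} (hf : Ord k f) :
    Tendsto f (𝓝[>] 0) (𝓝 0) := by
  have h1 : Ord 1 f := hf.mono hk
  refine IsBigO.trans_tendsto h1 ?_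
  simp only [pow_one]
  exact tendsto_id.mono_left nhdsWithin_le_nhds

/-- Second-order Taylor estimate, uniform in the base point. -/
theorem taylor_two {f : E → G} {x₀ : E} (hf : ContDiff ℝ 2 f) {p q : ℝ → E} {k : ℕ}
    (hk : 1 ≤ k) (hp : Tendsto p (𝓝[>] 0) (𝓝 x₀)) (hpq : Ord k (fun h => q h - p h)) :
    Ord (k + k) (fun h => f (q h) - f (p h) - fderiv ℝ f (p h) (q h - p h)) := by
  have hfd : ContDiffAt ℝ 1 (fderiv ℝ f) x₀ :=
    hf.contDiffAt.fderiv_right (by norm_num)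
  obtain ⟨K, s, hs, hK⟩ := hfd.exists_lipschitzOnWith
  obtain ⟨ε, hε, hball⟩ := Metric.mem_nhds_iff.1 hs
  have hq : Tendsto q (𝓝[>] 0) (𝓝 x₀) := by
    have := hp.add (hpq.tendsto hk)
    simpa using this
  have h2 := hpq.norm_left.mul hpq.norm_left
  have h3 : (fun h => f (q h) - f (p h) - fderiv ℝ f (p h) (q h - p h)) =O[𝓝[>] (0 : ℝ)]
      (fun h => ‖q h - p h‖ * ‖q h - p h‖) := by
    refine IsBigO.of_bound K ?_
    filter_upwards [hp (Metric.ball_mem_nhds _ hε), hq (Metric.ball_mem_nhds _ hε)] with h h1 h2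
    have hseg : segment ℝ (p h) (q h) ⊆ Metric.ball x₀ ε :=
      (convex_ball x₀ ε).segment_subset h1 h2
    have := Convex.norm_image_sub_le_of_norm_fderiv_le' (𝕜 := ℝ) (f := f)
      (C := K * ‖q h - p h‖) (s := segment ℝ (p h) (q h)) (x := p h) (y := q h)
      (φ := fderiv ℝ f (p h))
      (fun x _ => (hf.differentiable (by norm_num)) x)
      (fun x hx => by
        have := hK.dist_le_mul x (hball (hseg hx)) (p h) (hball h1)
        rw [dist_eq_norm, dist_eq_norm] at this
        refine this.trans ?_
        gcongr
        exact norm_sub_le_of_mem_segment hx)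
      (convex_segment _ _) (left_mem_segment _ _ _) (right_mem_segment _ _ _)
    rw [norm_mul, norm_norm, ← mul_assoc]
    exact this
  refine h3.trans ?_
  simpa [pow_add] using h2

/-- Cubic expansion of a `C⁴` derivative and the integrated expansion. -/
theorem expansion {z g : ℝ → E} {t ε : ℝ} (hε : 0 < ε)
    (hg : ContDiffOn ℝ 4 g (Icc t (t + ε)))
    (hz : ∀ s ∈ Icc t (t + ε), HasDerivAt z (g s) s) :
    ∃ b₀ b₁ b₂ b₃ : E,
      Ord 4 (fun h => g (t + h) - (b₀ + h • b₁ + h ^ 2 • b₂ + h ^ 3 • b₃)) ∧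
      Ord 5 (fun h => z (t + h) - (z t + h • b₀ + (h ^ 2 / 2) • b₁ + (h ^ 3 / 3) • b₂
        + (h ^ 4 / 4) • b₃)) ∧ g t = b₀ := by
  obtain ⟨C, hC⟩ := exists_taylor_mean_remainder_bound (f := g) (n := 3) (a := t) (b := t + ε)
    (by linarith) (by norm_num; exact hg)
  simp only [taylor_within_apply, Finset.sum_range_succ, Finset.sum_range_zero] at hC
  set D : ℕ → E := fun k => iteratedDerivWithin k g (Icc t (t + ε)) t with hD
  have key : ∀ h ∈ Icc (0 : ℝ) ε,
      ‖g (t + h) - (D 0 + h • D 1 + h ^ 2 • ((1 / 2 : ℝ) • D 2) + h ^ 3 • ((1 / 6 : ℝ) • D 3))‖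
        ≤ C * h ^ 4 := by
    intro h hh
    have := hC (t + h) ⟨by linarith [hh.1], by linarith [hh.2]⟩
    have e : t + h - t = h := by ring
    rw [e] at this
    refine le_trans (le_of_eq ?_) this
    congr 2
    simp only [hD, Nat.factorial]
    push_cast
    module
  have hC0 : 0 ≤ C := by
    have := (norm_nonneg _).trans (key ε ⟨hε.le, le_rfl⟩)
    have h4 : 0 < ε ^ 4 := by positivity
    by_contra hneg
    nlinarith
  refine ⟨D 0, D 1, (1 / 2 : ℝ) • D 2, (1 / 6 : ℝ) • D 3, ?_, ?_, ?_⟩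
  · refine IsBigO.of_bound C ?_
    filter_upwards [Ioo_mem_nhdsGT hε] with h hh
    have := key h ⟨hh.1.le, hh.2.le⟩
    rwa [Real.norm_eq_abs, abs_of_pos (pow_pos hh.1 4)]
  · refine IsBigO.of_bound C ?_
    filter_upwards [Ioo_mem_nhdsGT hε] with h hh
    rw [Real.norm_eq_abs, abs_of_pos (pow_pos hh.1 5)]
    generalize (1 / 2 : ℝ) • D 2 = c₂ at *
    generalize (1 / 6 : ℝ) • D 3 = c₃ at *
    have hder : ∀ x ∈ Icc (0 : ℝ) h, HasDerivWithinAt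
        (fun h => z (t + h) - (z t + h • D 0 + (h ^ 2 / 2) • D 1 + (h ^ 3 / 3) • c₂
        + (h ^ 4 / 4) • c₃))
        (g (t + x) - (D 0 + x • D 1 + x ^ 2 • c₂ + x ^ 3 • c₃)) (Icc 0 h) x := by
      intro x hx
      have h1 : HasDerivAt (fun h => z (t + h)) (g (t + x)) x := by
        have := hz (t + x) ⟨by linarith [hx.1], by linarith [hx.2, hh.2]⟩
        exact this.comp_const_add t x
      have p1 := (hasDerivAt_id x).smul_const (D 0)
      have p2 := (((hasDerivAt_id x).pow 2).div_const 2).smul_const (D 1)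
      have p3 := (((hasDerivAt_id x).pow 3).div_const 3).smul_const c₂
      have p4 := (((hasDerivAt_id x).pow 4).div_const 4).smul_const c₃
      have := h1.sub ((((p1.const_add (z t)).add p2).add p3).add p4)
      refine (this.congr_deriv ?_).hasDerivWithinAt
      simp only [id, Nat.cast_ofNat]
      norm_num
    have := norm_image_sub_le_of_norm_deriv_le_segment' hder (C := C * h ^ 4)
      (fun x hx => (key x ⟨hx.1, by linarith [hx.2, hh.2]⟩).trans (by
        have := hx.1
        have := hx.2.le
        gcongr)) h ⟨hh.1.le, le_rfl⟩
    simp at this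
    refine this.trans (le_of_eq (by ring))
  · have := key 0 ⟨le_rfl, hε.le⟩
    simp at this
    exact sub_eq_zero.1 this

/-- The right-hand side along a solution is `C⁴`. -/
theorem smooth_rhs {F : E × ℝ → E} {z : ℝ → E} {V : Set ℝ} (hV : IsOpen V)
    (hF : ContDiff ℝ 4 F) (hz : ∀ s ∈ V, HasDerivAt z (F (z s, s)) s) :
    ContDiffOn ℝ 4 (fun s => F (z s, s)) V := by
  have hd : DifferentiableOn ℝ z V := fun s hs => (hz s hs).differentiableAt.differentiableWithinAt
  have step : ∀ k : ℕ, k ≤ 4 → ContDiffOn ℝ k z V → ContDiffOn ℝ k (fun s => F (z s, s)) V := by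
    intro k hk h
    exact (hF.of_le (by exact_mod_cast hk)).comp_contDiffOn (h.prodMk contDiffOn_id)
  have main : ∀ k : ℕ, k ≤ 4 → ContDiffOn ℝ k z V := by
    intro k
    induction k with
    | zero => intro _; exact_mod_cast contDiffOn_zero.2 hd.continuousOn
    | succ k ih =>
      intro hk
      push_cast
      rw [contDiffOn_succ_iff_deriv_of_isOpen hV]
      refine ⟨hd, fun h => by simp at h, ?_⟩
      exact (step k (by omega) (ih (by omega))).congr (fun s hs => (hz s hs).deriv)
  exact_mod_cast step 4 le_rfl (main 4 le_rfl)

/-- The abstract error analysis. -/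
theorem core {F : E × ℝ → E} {z : ℝ → E} {t : ℝ} {U : Set ℝ} (hF : ContDiff ℝ 4 F)
    (hU : U ∈ 𝓝 t) (hz : ∀ s ∈ U, HasDerivAt z (F (z s, s)) s) {K₂ K₃ K₄ : ℝ → E}
    (hK₂ : ∀ h, K₂ h = F (z t + (h / 2) • F (z t, t), t + h / 2))
    (hK₃ : ∀ h, K₃ h = F (z t + (h / 2) • K₂ h, t + h / 2))
    (hK₄ : ∀ h, K₄ h = F (z t + h • K₃ h, t + h)) :
    Ord 5 (fun h => z (t + h) - (z t + (h / 6) • (F (z t, t) + (2 : ℕ) • K₂ h + (2 : ℕ) • K₃ h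
      + K₄ h))) := by
  obtain ⟨ε', hε', hball⟩ := Metric.mem_nhds_iff.1 hU
  have hzb : ∀ s ∈ Metric.ball t ε', HasDerivAt z (F (z s, s)) s := fun s hs => hz s (hball hs)
  have hsm := smooth_rhs Metric.isOpen_ball hF hzb
  have hsub : Icc t (t + ε' / 2) ⊆ Metric.ball t ε' := by
    intro s hs
    rw [Metric.mem_ball, Real.dist_eq, abs_lt]
    constructor <;> linarith [hs.1, hs.2]
  obtain ⟨b₀, b₁, b₂, b₃, hQ, hX, hb⟩ := expansion (half_pos hε') (hsm.mono hsub)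
    (fun s hs => hzb s (hsub hs))
  have hQ2 := hQ.half
  have hX2 := hX.half
  rw [hb] at hK₂ ⊢
  -- names
  set a := z t with ha
  obtain ⟨x, hx⟩ : ∃ x : ℝ → E, ∀ h, x h = z (t + h) := ⟨_, fun _ => rfl⟩
  obtain ⟨m, hm⟩ : ∃ m : ℝ → E, ∀ h, m h = z (t + h / 2) := ⟨_, fun _ => rfl⟩
  obtain ⟨gm, hgm⟩ : ∃ g : ℝ → E, ∀ h, g h = F (m h, t + h / 2) := ⟨_, fun _ => rfl⟩
  obtain ⟨g1, hg1⟩ : ∃ g : ℝ → E, ∀ h, g h = F (x h, t + h) := ⟨_, fun _ => rfl⟩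
  simp only [← hm, ← hgm] at hQ2 hX2
  simp only [← hx, ← hg1] at hQ hX ⊢
  have H1 : Ord 5 (fun h => x h - a - (h / 6) • (b₀ + (4 : ℝ) • gm h + g1 h)) :=
    ((hX.sub (hQ2.hsmul.smulc (4 / 6))).sub (hQ.hsmul.smulc (1 / 6))).congr (fun h => by module)
  have H2 : Ord 4 (fun h => (5 : ℝ) • a + h • b₀ + (2 * h) • gm h - (4 : ℝ) • m h - x h) :=
    ((((hQ2.hsmul.smulc 2).mono' (by norm_num)).sub ((hX2.mono' (by norm_num : 4 ≤ 5)).smulc 4)).sub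
      (hX.mono' (by norm_num))).add (Ord.pow 4 ((-1 / 16 : ℝ) • b₃)) |>.congr (fun h => by module)
  have H3 : Ord 3 (fun h => (2 : ℝ) • a + (h / 2) • (b₀ + gm h) - (2 : ℝ) • m h) :=
    (((hQ2.hsmul.smulc (1 / 2)).sub (hX2.smulc 2)).mono' (by norm_num)).add
      ((Ord.pow 3 ((1 / 24 : ℝ) • b₂)).add
        ((Ord.pow 4 ((1 / 32 : ℝ) • b₃)).mono' (by norm_num))) |>.congr (fun h => by module)
  have H4 : Ord 3 (fun h => a + h • gm h - x h) :=
    (((hQ2.hsmul).sub hX).mono' (by norm_num)).add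
      ((Ord.pow 3 ((-1 / 12 : ℝ) • b₂)).add
        ((Ord.pow 4 ((-1 / 8 : ℝ) • b₃)).mono' (by norm_num))) |>.congr (fun h => by module)
  have H5 : Ord 2 (fun h => a + (h / 2) • b₀ - m h) :=
    ((hX2.smulc (-1)).mono' (by norm_num)).add
      ((Ord.pow 2 ((-1 / 8 : ℝ) • b₁)).add (((Ord.pow 3 ((-1 / 24 : ℝ) • b₂)).mono' (by norm_num)).add
        ((Ord.pow 4 ((-1 / 64 : ℝ) • b₃)).mono' (by norm_num)))) |>.congr (fun h => by module)
  have H6 : Ord 2 (fun h => a + (h / 2) • gm h - m h) :=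
    ((H3.mono' (by norm_num)).sub H5).congr (fun h => by module)
  -- the solution curve
  have hzt : HasDerivAt z (F (z t, t)) t := hz t (mem_of_mem_nhds hU)
  have hcurve : DifferentiableAt ℝ (fun h : ℝ => (z (t + h), t + h)) 0 := by
    have h1 : DifferentiableAt ℝ (fun h : ℝ => t + h) 0 := by fun_prop
    have h2 : DifferentiableAt ℝ z (t + 0) := by simpa using hzt.differentiableAt
    exact (h2.comp (0 : ℝ) h1).prodMk h1
  have hfd : Differentiable ℝ (fderiv ℝ F) :=
    (hF.fderiv_right (m := 3) (by norm_num)).differentiable (by norm_num)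
  have hAd : DifferentiableAt ℝ (fun h : ℝ => (fderiv ℝ F (z (t + h), t + h)).comp
      (ContinuousLinearMap.inl ℝ E ℝ)) 0 :=
    ((hfd _).comp (0 : ℝ) hcurve).clm_comp (differentiableAt_const _)
  have hA : Ord 1 (fun h => (fderiv ℝ F (z (t + h), t + h)).comp (ContinuousLinearMap.inl ℝ E ℝ)
      - (fderiv ℝ F (a, t)).comp (ContinuousLinearMap.inl ℝ E ℝ)) := by
    have := hAd.isBigO_sub.mono (nhdsWithin_le_nhds (s := Ioi 0))
    unfold Ord
    simpa using this
  have hAm := hA.half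
  have hc1 : Tendsto (fun h => (x h, t + h)) (𝓝[>] 0) (𝓝 (a, t)) := by
    have := hcurve.continuousAt.tendsto.mono_left (nhdsWithin_le_nhds (s := Ioi 0))
    simpa [hx] using this
  have hcm : Tendsto (fun h => (m h, t + h / 2)) (𝓝[>] 0) (𝓝 (a, t)) := by
    have h0 : Tendsto (fun h : ℝ => h / 2) (𝓝[>] 0) (𝓝 0) := by
      have : Tendsto (fun h : ℝ => h / 2) (𝓝 0) (𝓝 (0 / 2)) := tendsto_id.div_const 2
      rw [zero_div] at this
      exact this.mono_left nhdsWithin_le_nhds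
    have := hcurve.continuousAt.tendsto.comp h0
    simpa [hm, Function.comp_def] using this
  obtain ⟨A0, hA0⟩ : ∃ A : E →L[ℝ] E, A = (fderiv ℝ F (a, t)).comp
    (ContinuousLinearMap.inl ℝ E ℝ) := ⟨_, rfl⟩
  obtain ⟨Am, hAm'⟩ : ∃ A : ℝ → E →L[ℝ] E, ∀ h, A h = (fderiv ℝ F (m h, t + h / 2)).comp
    (ContinuousLinearMap.inl ℝ E ℝ) := ⟨_, fun _ => rfl⟩
  obtain ⟨A1, hA1'⟩ : ∃ A : ℝ → E →L[ℝ] E, ∀ h, A h = (fderiv ℝ F (x h, t + h)).comp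
    (ContinuousLinearMap.inl ℝ E ℝ) := ⟨_, fun _ => rfl⟩
  simp only [← hm, ← hA0, ← hAm'] at hAm
  simp only [← hx, ← hA0, ← hA1'] at hA
  have hAm0 : Ord 0 Am := ((hAm.mono' (by norm_num)).add (Ord.const A0)).congr (fun h => by simp)
  -- Taylor at the stages
  have hF2 : ContDiff ℝ 2 F := hF.of_le (by norm_num)
  have Tm : ∀ (Y : ℝ → E) , Ord 2 (fun h => Y h - m h) →
      Ord 4 (fun h => F (Y h, t + h / 2) - gm h - Am h (Y h - m h)) := by
    intro Y hY
    have h1 : Ord 2 (fun h => (Y h, t + h / 2) - (m h, t + h / 2)) := by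
      refine IsBigO.trans ?_ hY
      exact IsBigO.of_bound' (Eventually.of_forall fun h => by simp)
    refine (taylor_two hF2 (by norm_num) hcm h1).congr (fun h => by simp [hAm', hgm])
  have T1 : ∀ (Y : ℝ → E) , Ord 3 (fun h => Y h - x h) →
      Ord 4 (fun h => F (Y h, t + h) - g1 h - A1 h (Y h - x h)) := by
    intro Y hY
    have h1 : Ord 3 (fun h => (Y h, t + h) - (x h, t + h)) := by
      refine IsBigO.trans ?_ hY
      exact IsBigO.of_bound' (Eventually.of_forall fun h => by simp)
    refine ((taylor_two hF2 (by norm_num) hc1 h1).mono' (by norm_num : 4 ≤ 3 + 3)).congr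
      (fun h => by simp [hA1', hg1])
  -- stage 2
  obtain ⟨d2, hd2⟩ : ∃ d : ℝ → E, ∀ h, d h = a + (h / 2) • b₀ - m h := ⟨_, fun _ => rfl⟩
  obtain ⟨d3, hd3⟩ : ∃ d : ℝ → E, ∀ h, d h = a + (h / 2) • K₂ h - m h := ⟨_, fun _ => rfl⟩
  obtain ⟨d4, hd4⟩ : ∃ d : ℝ → E, ∀ h, d h = a + h • K₃ h - x h := ⟨_, fun _ => rfl⟩
  have S2 : Ord 4 (fun h => K₂ h - gm h - Am h (d2 h)) :=
    (Tm _ H5).congr (fun h => by rw [hK₂, hd2])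
  have D2 : Ord 2 d2 := H5.congr hd2
  have L2 : Ord 2 (fun h => K₂ h - gm h) :=
    ((S2.mono' (by norm_num)).add ((hAm0.bil D2).mono' (by norm_num))).congr
      (fun h => by module)
  have D3 : Ord 2 d3 :=
    (H6.add ((L2.hsmul.smulc (1 / 2)).mono' (by norm_num))).congr
      (fun h => by rw [hd3]; module)
  have S3 : Ord 4 (fun h => K₃ h - gm h - Am h (d3 h)) :=
    (Tm _ (D3.congr (fun h => (hd3 h).symm))).congr (fun h => by rw [hK₃, hd3])
  have D23 : Ord 3 (fun h => d2 h + d3 h) :=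
    (H3.add (L2.hsmul.smulc (1 / 2))).congr (fun h => by rw [hd3, hd2]; module)
  have L3 : Ord 2 (fun h => K₃ h - gm h) :=
    ((S3.mono' (by norm_num)).add ((hAm0.bil D3).mono' (by norm_num))).congr
      (fun h => by module)
  have D4 : Ord 3 d4 := (H4.add L3.hsmul).congr (fun h => by rw [hd4]; module)
  have S4 : Ord 4 (fun h => K₄ h - g1 h - A1 h (d4 h)) :=
    (T1 _ (D4.congr (fun h => (hd4 h).symm))).congr (fun h => by rw [hK₄, hd4])
  have L23 : Ord 3 (fun h => K₂ h - gm h + (K₃ h - gm h)) :=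
    (((S2.add S3).mono' (by norm_num)).add ((hAm0.bil D23).mono' (by norm_num))).congr
      (fun h => by rw [map_add]; module)
  have D234 : Ord 4 (fun h => (2 : ℝ) • (d2 h + d3 h) + d4 h) :=
    (H2.add L23.hsmul).congr (fun h => by rw [hd2, hd3, hd4]; module)
  have B1 : Ord 4 (fun h => (Am h - A0) (d2 h + d3 h)) := (hAm.bil D23)
  have B2 : Ord 4 (fun h => (A1 h - A0) (d4 h)) := (hA.bil D4)
  have B3 : Ord 4 (fun h => A0 ((2 : ℝ) • (d2 h + d3 h) + d4 h)) :=
    ((Ord.const A0).bil D234).mono' (by norm_num)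
  have Tot : Ord 4 (fun h => (2 : ℝ) • (K₂ h - gm h) + (2 : ℝ) • (K₃ h - gm h)
      + (K₄ h - g1 h)) :=
    (((((S2.add S3).smulc 2).add S4).add (B1.smulc 2)).add (B2.add B3)).congr (fun h => by
      simp only [sub_apply, map_add, map_smul]
      module)
  exact (H1.sub (Tot.hsmul.smulc (1 / 6))).congr (fun h => by module)

end RK4Aux

/-- Local truncation error of a single classical four-stage Runge–Kutta step is `O(h⁵)`:
if `F : ℝⁿ × ℝ → ℝⁿ` is `C⁴` and `Φ` solves `Φ' = F(Φ, ·)` on a neighborhood of `t`,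
then there are `C > 0` and `h₀ > 0` such that for all `0 < h ≤ h₀`,
`‖Φ(t+h) − (Φ(t) + (h/6)(K₁ + 2K₂ + 2K₃ + K₄))‖ ≤ C·h⁵`. -/
theorem rk4_local_truncation_error
    {n : ℕ} (F : (Fin n → ℝ) × ℝ → Fin n → ℝ) (Φ : ℝ → Fin n → ℝ) (t : ℝ)
    (hF : ContDiff ℝ 4 F)
    (U : Set ℝ) (hU : U ∈ nhds t)
    (hODE : ∀ s ∈ U, HasDerivAt Φ (F (Φ s, s)) s) :
    ∃ C > (0 : ℝ), ∃ h₀ > (0 : ℝ), ∀ h : ℝ, 0 < h → h ≤ h₀ →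
      let K₁ := F (Φ t, t)
      let K₂ := F (Φ t + (h / 2) • K₁, t + h / 2)
      let K₃ := F (Φ t + (h / 2) • K₂, t + h / 2)
      let K₄ := F (Φ t + h • K₃, t + h)
      ‖Φ (t + h) - (Φ t + (h / 6) • (K₁ + 2 • K₂ + 2 • K₃ + K₄))‖ ≤ C * h ^ 5 := by
  have h := RK4Aux.core (K₂ := fun h => F (Φ t + (h / 2) • F (Φ t, t), t + h / 2))
    (K₃ := fun h => F (Φ t + (h / 2) • F (Φ t + (h / 2) • F (Φ t, t), t + h / 2), t + h / 2))
    (K₄ := fun h => F (Φ t + h • F (Φ t + (h / 2) • F (Φ t + (h / 2) • F (Φ t, t), t + h / 2),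
      t + h / 2), t + h)) hF hU hODE (fun _ => rfl) (fun _ => rfl) (fun _ => rfl)
  obtain ⟨C, hC, hb⟩ := Asymptotics.IsBigO.exists_pos h
  obtain ⟨u, hu, hsub⟩ := mem_nhdsGT_iff_exists_Ioc_subset.1 hb.bound
  refine ⟨C, hC, u, hu, fun h h0 h1 => ?_⟩
  have := hsub ⟨h0, h1⟩
  simp only [Set.mem_ofPred_eq, Real.norm_eq_abs, abs_of_pos (pow_pos h0 5)] at this
  exact this
end

section
/- Let F : ℝⁿ × ℝ → ℝⁿ be four times continuously differentiable with all derivatives up to order four bounded (in particular F is uniformly Lipschitz in its first argument), and let Φ : [a, b] → ℝⁿ be a solution of Φ'(s) = F(Φ(s), s). For an integer M ≥ 1 set h = (b − a)/M, τ_s = a + s·h, and define the M-stage recursive Runge–Kutta iterates by Φ₀ = Φ(a) and Φ_{s+1} = Φ_s + (h/6)·(K_{s1} + 2K_{s2} + 2K_{s3} + K_{s4}), where K_{s1} = F(Φ_s, τ_s), K_{s2} = F(Φ_s + (h/2)K_{s1}, τ_s + h/2), K_{s3} = F(Φ_s + (h/2)K_{s2}, τ_s + h/2), K_{s4} = F(Φ_s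 + h·K_{s3}, τ_{s+1}). Then there exist C > 0 and M₀ such that for all M ≥ M₀ the endpoint error satisfies ‖Φ(b) − Φ_M‖ ≤ C·((b − a)/M)⁴, i.e. the M-stage recursive Runge–Kutta scheme is fourth-order accurate in the stage step size. -/
set_option synthInstance.maxHeartbeats 400000
set_option maxSynthPendingDepth 10
theorem T0 {E V : Type*} [NormedAddCommGroup E] [NormedSpace ℝ E] [NormedAddCommGroup V] [NormedSpace ℝ V]
  (f : E → V) (K : ℝ) (hf : Differentiable ℝ f) (hb : ∀ z, ‖fderiv ℝ f z‖ ≤ K) (y v : E) :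
  ‖f (y+v) - f y‖ ≤ K * ‖v‖ := by
  have := Convex.norm_image_sub_le_of_norm_fderiv_le (𝕜 := ℝ) (s := Set.univ) (f := f) (C := K) (x := y) (y := y+v)
    (fun x _ => hf x) (fun x _ => hb x) convex_univ (Set.mem_univ _) (Set.mem_univ _)
  simpa using this

theorem polyDeriv {V : Type*} [NormedAddCommGroup V] [NormedSpace ℝ V] (a b c d : V) (s : ℝ) :
    HasDerivAt (fun s : ℝ => s • a + s^2 • b + s^3 • c + s^4 • d)
      (a + (2*s) • b + (3*s^2) • c + (4*s^3) • d) s := by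
  have h1 := (hasDerivAt_id s).smul_const a
  have h2 := (hasDerivAt_pow 2 s).smul_const b
  have h3 := (hasDerivAt_pow 3 s).smul_const c
  have h4 := (hasDerivAt_pow 4 s).smul_const d
  have := ((h1.add h2).add h3).add h4
  simp only [id, one_smul] at this
  norm_num at this
  exact this

theorem Tstep {E V : Type*} [NormedAddCommGroup E] [NormedSpace ℝ E] [NormedAddCommGroup V] [NormedSpace ℝ V]
  (f : E → V) (hf : Differentiable ℝ f) (y v : E) (p : ℝ → V) (p' : ℝ → E →L[ℝ] V) (c : ℝ)
  (hp : ∀ s, HasDerivAt p (p' s v) s)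
  (hb : ∀ s ∈ Set.Ico (0:ℝ) 1, ‖fderiv ℝ f (y + s • v) - p' s‖ ≤ c) :
  ‖(f (y+v) - p 1) - (f y - p 0)‖ ≤ c * ‖v‖ := by
  have := norm_image_sub_le_of_norm_deriv_le_segment_01' (f := fun s : ℝ => f (y + s • v) - p s)
    (f' := fun s => (fderiv ℝ f (y + s • v) - p' s) v) (C := c * ‖v‖) ?_ ?_
  · simpa using this
  · intro s _
    have h1 : HasDerivAt (fun s : ℝ => y + s • v) v s := by
      simpa using ((hasDerivAt_id s).smul_const v).const_add y
    have := ((hf (y + s • v)).hasFDerivAt.comp_hasDerivAt s h1).sub (hp s)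
    exact this.hasDerivWithinAt
  · intro s hs
    exact (ContinuousLinearMap.le_opNorm _ _).trans (by gcongr; exact hb s hs)

section
variable {E V : Type*} [NormedAddCommGroup E] [NormedSpace ℝ E] [NormedAddCommGroup V] [NormedSpace ℝ V]

theorem T1 (f : E → V) (K : ℝ) (hK : 0 ≤ K) (hf : ContDiff ℝ 2 f)
   (hb : ∀ z, ‖fderiv ℝ (fderiv ℝ f) z‖ ≤ K) (y v : E) :
   ‖f (y+v) - (f y + fderiv ℝ f y v)‖ ≤ K * ‖v‖^2 := by
  have hd : ContDiff ℝ 1 (fderiv ℝ f) := hf.fderiv_right (by norm_num)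
  have := Tstep f (hf.differentiable (by norm_num)) y v (fun s => s • fderiv ℝ f y v)
    (fun s => fderiv ℝ f y) (K * ‖v‖) ?_ ?_
  · convert this using 1
    · congr 1; simp; abel
    · ring
  · intro s
    simpa using (hasDerivAt_id s).smul_const (fderiv ℝ f y v)
  · intro s hs
    refine (T0 _ K (hd.differentiable (by norm_num)) hb y (s • v)).trans ?_
    rw [norm_smul, Real.norm_of_nonneg hs.1]
    have h0 := hs.1
    have : s * ‖v‖ ≤ ‖v‖ := mul_le_of_le_one_left (norm_nonneg _) hs.2.le
    gcongr

theorem T2 (f : E → V) (K : ℝ) (hK : 0 ≤ K) (hf : ContDiff ℝ 3 f)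
   (hb : ∀ z, ‖fderiv ℝ (fderiv ℝ (fderiv ℝ f)) z‖ ≤ K) (y v : E) :
   ‖f (y+v) - (f y + fderiv ℝ f y v + (1/2:ℝ) • fderiv ℝ (fderiv ℝ f) y v v)‖ ≤ K * ‖v‖^3 := by
  have hd : ContDiff ℝ 2 (fderiv ℝ f) := hf.fderiv_right (by norm_num)
  have := Tstep f (hf.differentiable (by norm_num)) y v
    (fun s => s • fderiv ℝ f y v + (s^2/2) • fderiv ℝ (fderiv ℝ f) y v v)
    (fun s => fderiv ℝ f y + s • fderiv ℝ (fderiv ℝ f) y v) (K * ‖v‖^2) ?_ ?_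
  · convert this using 1
    · congr 1; simp; abel
    · ring
  · intro s
    convert polyDeriv (fderiv ℝ f y v) ((1/2:ℝ) • fderiv ℝ (fderiv ℝ f) y v v) 0 0 s using 1
    · funext s; module
    · rw [add_apply, smul_apply]; module
  · intro s hs
    have := T1 _ K hK hd hb y (s • v)
    simp only [map_smul] at this
    refine this.trans ?_
    rw [norm_smul, Real.norm_of_nonneg hs.1]
    have h0 := hs.1
    have : s * ‖v‖ ≤ ‖v‖ := mul_le_of_le_one_left (norm_nonneg _) hs.2.le
    gcongr

theorem T3 (f : E → V) (K : ℝ) (hK : 0 ≤ K) (hf : ContDiff ℝ 4 f)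
   (hb : ∀ z, ‖fderiv ℝ (fderiv ℝ (fderiv ℝ (fderiv ℝ f))) z‖ ≤ K) (y v : E) :
   ‖f (y+v) - (f y + fderiv ℝ f y v + (1/2:ℝ) • fderiv ℝ (fderiv ℝ f) y v v
    + (1/6:ℝ) • fderiv ℝ (fderiv ℝ (fderiv ℝ f)) y v v v)‖ ≤ K * ‖v‖^4 := by
  have hd : ContDiff ℝ 3 (fderiv ℝ f) := hf.fderiv_right (by norm_num)
  have := Tstep f (hf.differentiable (by norm_num)) y v
    (fun s => s • fderiv ℝ f y v + (s^2/2) • fderiv ℝ (fderiv ℝ f) y v v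
      + (s^3/6) • fderiv ℝ (fderiv ℝ (fderiv ℝ f)) y v v v)
    (fun s => fderiv ℝ f y + s • fderiv ℝ (fderiv ℝ f) y v
      + (s^2/2) • fderiv ℝ (fderiv ℝ (fderiv ℝ f)) y v v) (K * ‖v‖^3) ?_ ?_
  · convert this using 1
    · congr 1; simp; abel
    · ring
  · intro s
    convert polyDeriv (fderiv ℝ f y v) ((1/2:ℝ) • fderiv ℝ (fderiv ℝ f) y v v)
      ((1/6:ℝ) • fderiv ℝ (fderiv ℝ (fderiv ℝ f)) y v v v) 0 s using 1
    · funext s; module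
    · rw [add_apply, add_apply, smul_apply, smul_apply]; module
  · intro s hs
    have := T2 _ K hK hd hb y (s • v)
    have e : (1/2:ℝ) • fderiv ℝ (fderiv ℝ (fderiv ℝ f)) y (s • v) (s • v)
      = (s^2/2) • fderiv ℝ (fderiv ℝ (fderiv ℝ f)) y v v := by
      simp only [map_smul, smul_apply]; module
    rw [e] at this
    simp only [map_smul] at this
    refine this.trans ?_
    rw [norm_smul, Real.norm_of_nonneg hs.1]
    have h0 := hs.1
    have : s * ‖v‖ ≤ ‖v‖ := mul_le_of_le_one_left (norm_nonneg _) hs.2.le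
    gcongr
end

section
variable {E : Type*} [NormedAddCommGroup E] [NormedSpace ℝ E]

structure TB (g : E → E) (K : ℝ) (y : E) (A : E →L[ℝ] E) (B : E →L[ℝ] E →L[ℝ] E)
    (C : E →L[ℝ] E →L[ℝ] E →L[ℝ] E) : Prop where
  hA : ∀ u, ‖A u‖ ≤ K * ‖u‖
  hB : ∀ u v, ‖B u v‖ ≤ K * ‖u‖ * ‖v‖
  hC : ∀ u v w, ‖C u v w‖ ≤ K * ‖u‖ * ‖v‖ * ‖w‖
  hT : ∀ v, ‖g (y+v) - (g y + A v + B v v + C v v v)‖ ≤ K * ‖v‖^4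

def DD (K L : ℝ) : ℝ := 81*K*L^4 + 6*K*L^2 + 54*K*L^3

theorem X3 {g : E → E} {K : ℝ} {y : E} {A : E →L[ℝ] E} {B : E →L[ℝ] E →L[ℝ] E}
    {C : E →L[ℝ] E →L[ℝ] E →L[ℝ] E} (hK : 0 ≤ K) (h : TB g K y A B C)
    (hL : ∀ u v, ‖g u - g v‖ ≤ K * ‖u - v‖) {L e s : ℝ} (hs0 : 0 ≤ s) (hs1 : s ≤ 1)
    {a₁ a₂ a₃ v : E} (h1 : ‖a₁‖ ≤ L) (h2 : ‖a₂‖ ≤ L) (h3 : ‖a₃‖ ≤ L)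
    (hv : ‖v - (s • a₁ + s^2 • a₂ + s^3 • a₃)‖ ≤ e * s^4) :
    ‖g (y+v) - (g y + s • A a₁ + s^2 • (A a₂ + B a₁ a₁)
      + s^3 • (A a₃ + B a₁ a₂ + B a₂ a₁ + C a₁ a₁ a₁))‖ ≤ (K * e + DD K L) * s^4 := by
  have hL0 : 0 ≤ L := (norm_nonneg _).trans h1
  obtain ⟨q, hq⟩ : ∃ q, q = a₂ + s • a₃ := ⟨_, rfl⟩
  obtain ⟨p, hp⟩ : ∃ p, p = s • a₁ + s^2 • a₂ + s^3 • a₃ := ⟨_, rfl⟩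
  have hpq : p = s • a₁ + s^2 • q := by rw [hp, hq]; module
  have nq : ‖q‖ ≤ 2 * L := by
    rw [hq]; refine (norm_add_le _ _).trans ?_
    rw [norm_smul, Real.norm_of_nonneg hs0]
    nlinarith [norm_nonneg a₃]
  have nsq : ‖s^2 • q‖ ≤ 2 * L * s^2 := by
    rw [norm_smul, Real.norm_of_nonneg (by positivity), mul_comm]
    gcongr
  have nsa : ‖s • a₁‖ ≤ L * s := by
    rw [norm_smul, Real.norm_of_nonneg hs0, mul_comm]
    gcongr
  have np : ‖p‖ ≤ 3 * L * s := by
    rw [hpq]; refine (norm_add_le _ _).trans ?_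
    have : L * s^2 ≤ L * s := by
      gcongr; nlinarith
    linarith
  have E1 : ‖g (y+v) - g (y+p)‖ ≤ K * (e * s^4) := by
    refine (hL _ _).trans ?_
    rw [add_sub_add_left_eq_sub, hp]; gcongr
  have E2 : ‖g (y+p) - (g y + A p + B p p + C p p p)‖ ≤ K * (3*L*s)^4 := by
    refine (h.hT p).trans ?_
    gcongr
  have E3 : ‖C (s^2 • q) p p + C (s • a₁) (s^2 • q) p + C (s • a₁) (s • a₁) (s^2 • q)‖
      ≤ K * (2 * L * s^2) * (3*L*s) * (3*L*s) + K * (L*s) * (2 * L * s^2) * (3*L*s)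
        + K * (L*s) * (L*s) * (2 * L * s^2) := by
    refine (norm_add₃_le).trans ?_
    refine add_le_add (add_le_add ?_ ?_) ?_ <;>
    · refine (h.hC _ _ _).trans ?_
      gcongr
  have E4 : ‖B a₁ a₃ + B a₃ a₁ + B q q‖ ≤ K * L * L + K * L * L + K * (2*L)*(2*L) := by
    refine (norm_add₃_le).trans ?_
    refine add_le_add (add_le_add ?_ ?_) ?_ <;>
    · refine (h.hB _ _).trans ?_
      gcongr
  have E4' : ‖s^4 • (B a₁ a₃ + B a₃ a₁ + B q q)‖ ≤ s^4 * (K * L * L + K * L * L + K * (2*L)*(2*L)) := by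
    rw [norm_smul, Real.norm_of_nonneg (by positivity)]
    gcongr
  have key : g (y+v) - (g y + s • A a₁ + s^2 • (A a₂ + B a₁ a₁)
      + s^3 • (A a₃ + B a₁ a₂ + B a₂ a₁ + C a₁ a₁ a₁)) =
      (g (y+v) - g (y+p)) + (g (y+p) - (g y + A p + B p p + C p p p))
      + (C (s^2 • q) p p + C (s • a₁) (s^2 • q) p + C (s • a₁) (s • a₁) (s^2 • q))
      + s^4 • (B a₁ a₃ + B a₃ a₁ + B q q) := by
    have c1 : C p p p = C (s^2 • q) p p + C (s • a₁) (s^2 • q) p + C (s • a₁) (s • a₁) (s^2 • q)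
       + s^3 • C a₁ a₁ a₁ := by
      rw [hpq]
      simp only [map_add, map_smul, add_apply, smul_apply]
      module
    have c2 : A p = s • A a₁ + s^2 • A a₂ + s^3 • A a₃ := by
      rw [hp]; simp only [map_add, map_smul]
    have c3 : B p p = s^2 • B a₁ a₁ + s^3 • (B a₁ a₂ + B a₂ a₁) + 
        s^4 • (B a₁ a₃ + B a₃ a₁ + B q q) := by
      rw [hp, hq]
      simp only [map_add, map_smul, add_apply, smul_apply]
      module
    rw [c1, c2, c3]
    module
  rw [key]
  refine (norm_add_le _ _).trans ((add_le_add ((norm_add_le _ _).trans (add_le_add ((norm_add_le _ _).trans (add_le_add E1 E2)) E3)) E4').trans ?_)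
  unfold DD
  have t1 : K * L^3 * s^5 ≤ K * L^3 * s^4 := by
    have : s^5 ≤ s^4 := pow_le_pow_of_le_one hs0 hs1 (by norm_num)
    gcongr
  nlinarith [mul_nonneg (mul_nonneg hK (pow_nonneg hL0 3)) (pow_nonneg hs0 4)]
end

section
variable {E : Type*} [NormedAddCommGroup E] [NormedSpace ℝ E]

noncomputable def rk (g : E → E) (h : ℝ) (y : E) : E :=
  y + (h/6) • (g y + (2:ℝ) • g (y + (h/2) • g y) + (2:ℝ) • g (y + (h/2) • g (y + (h/2) • g y))
    + g (y + h • g (y + (h/2) • g (y + (h/2) • g y))))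

theorem rk_lip {g : E → E} {K h : ℝ} (hK : 1 ≤ K)
    (hL : ∀ u v, ‖g u - g v‖ ≤ K * ‖u - v‖) (h0 : 0 ≤ h) (h1 : h ≤ 1) (y z : E) :
    ‖rk g h y - rk g h z‖ ≤ (1 + h * (3 * K^4)) * ‖y - z‖ := by
  have st : ∀ (c e : ℝ) (p q : E), 0 ≤ c → c ≤ 1 → ‖p - q‖ ≤ e →
      ‖g (y + c • p) - g (z + c • q)‖ ≤ K * (‖y - z‖ + e) := by
    intro c e p q hc hc1 hpq
    refine (hL _ _).trans ?_
    gcongr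
    have : y + c • p - (z + c • q) = (y - z) + c • (p - q) := by module
    rw [this]
    refine (norm_add_le _ _).trans ?_
    gcongr
    rw [norm_smul, Real.norm_of_nonneg hc]
    have := norm_nonneg (p - q)
    nlinarith
  have k1 := hL y z
  have k2 := st (h/2) _ _ _ (by linarith) (by linarith) k1
  have k3 := st (h/2) _ _ _ (by linarith) (by linarith) k2
  have k4 := st h _ _ _ (by linarith) (by linarith) k3
  have hd := norm_nonneg (y - z)
  have b12 : K ≤ K^2 := by nlinarith
  have b23 : K^2 ≤ K^3 := by nlinarith
  have b34 : K^3 ≤ K^4 := by nlinarith [pow_nonneg (by linarith : (0:ℝ) ≤ K) 3]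
  have key : rk g h y - rk g h z = (y - z) + (h/6) • ((g y - g z)
     + (2:ℝ) • (g (y + (h/2) • g y) - g (z + (h/2) • g z))
     + (2:ℝ) • (g (y + (h/2) • g (y + (h/2) • g y)) - g (z + (h/2) • g (z + (h/2) • g z)))
     + (g (y + h • g (y + (h/2) • g (y + (h/2) • g y)))
        - g (z + h • g (z + (h/2) • g (z + (h/2) • g z))))) := by
    unfold rk; module
  rw [key]
  refine (norm_add_le _ _).trans ?_
  rw [norm_smul, Real.norm_of_nonneg (by positivity : 0 ≤ h/6)]
  have S := (norm_add_le _ _).trans (add_le_add ((norm_add_le _ _).trans (add_le_add ((norm_add_le _ _).trans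
    (add_le_add k1 ((norm_smul_le (2:ℝ) _).trans (mul_le_mul_of_nonneg_left k2 (norm_nonneg _)))))
    ((norm_smul_le (2:ℝ) _).trans (mul_le_mul_of_nonneg_left k3 (norm_nonneg _))))) k4)
  have S2 := S.trans (show _ ≤ 15 * K^4 * ‖y - z‖ from ?_)
  · nlinarith [mul_le_mul_of_nonneg_left S2 (by positivity : 0 ≤ h/6), (by positivity : 0 ≤ h * K^4 * ‖y - z‖)]
  · rw [Real.norm_of_nonneg (by norm_num : (0:ℝ) ≤ 2)]
    have c1 := mul_le_mul_of_nonneg_right b12 hd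
    have c2 := mul_le_mul_of_nonneg_right b23 hd
    have c3 := mul_le_mul_of_nonneg_right b34 hd
    ring_nf at c1 c2 c3 ⊢
    linarith

noncomputable def errC (K : ℝ) : ℝ :=
  let L := K^4
  let D := DD K L
  let e3 := K * (D + L) + D
  (K * L + D) * Real.exp K + (2 * D + 2 * e3 + (K * (e3 + L) + D))

set_option maxHeartbeats 4000000 in
theorem local_err {g : E → E} {K h : ℝ} {y : E} {A : E →L[ℝ] E} {B : E →L[ℝ] E →L[ℝ] E}
    {C : E →L[ℝ] E →L[ℝ] E →L[ℝ] E} (hK : 1 ≤ K) (hT : TB g K y A B C)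
    (hL : ∀ u v, ‖g u - g v‖ ≤ K * ‖u - v‖) (hbd : ∀ u, ‖g u‖ ≤ K)
    (h0 : 0 ≤ h) (h1 : h ≤ 1) (u : ℝ → E) (hu : ∀ s ∈ Set.Icc 0 h, HasDerivAt u (g (u s)) s)
    (hu0 : u 0 = y) : ‖u h - rk g h y‖ ≤ errC K * h^5 := by
  have hK0 : 0 ≤ K := by linarith
  obtain ⟨a, ha⟩ : ∃ a, a = g y := ⟨_, rfl⟩
  have na : ‖a‖ ≤ K := ha ▸ hbd y
  obtain ⟨L, hLL⟩ : ∃ L, L = K^4 := ⟨_, rfl⟩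
  have b12 : K ≤ K^2 := by nlinarith
  have b23 : K^2 ≤ K^3 := by nlinarith
  have b34 : K^3 ≤ L := by rw [hLL]; nlinarith [pow_nonneg hK0 3]
  have nA : ∀ v c, ‖v‖ ≤ c → ‖A v‖ ≤ K * c := fun v c hv => (hT.hA v).trans (by gcongr)
  have nB : ∀ v w c d, ‖v‖ ≤ c → ‖w‖ ≤ d → ‖B v w‖ ≤ K * c * d := fun v w c d hv hw =>
    (hT.hB v w).trans (by have := (norm_nonneg v).trans hv; gcongr)
  have nAa := nA _ _ na
  have nAAa := nA _ _ nAa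
  have nBaa := nB _ _ _ _ na na
  have nABaa := nA _ _ nBaa
  have nAAAa := nA _ _ nAAa
  have nBaAa := nB _ _ _ _ na nAa
  have nBAaa := nB _ _ _ _ nAa na
  have nCaaa : ‖C a a a‖ ≤ K * K * K * K := (hT.hC a a a).trans (by gcongr)
  have e2 : K * K = K^2 := by ring
  have e3 : K * K * K = K^3 := by ring
  have e3' : K * (K * K) = K^3 := by ring
  have e4 : K * K * K * K = L := by rw [hLL]; ring
  have e4' : K * (K * K * K) = L := by rw [hLL]; ring
  have e4'' : K * (K * (K * K)) = L := by rw [hLL]; ring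
  have e4a : K * K * (K * K) = L := by rw [hLL]; ring
  have e4b : K * (K * K) * K = L := by rw [hLL]; ring
  rw [e2] at nAa
  rw [e3'] at nAAa
  rw [e3] at nBaa
  rw [e4'] at nABaa
  rw [e4''] at nAAAa
  rw [e4a] at nBaAa
  rw [e4b] at nBAaa
  rw [e4] at nCaaa
  have hL0 : 0 ≤ L := by rw [hLL]; positivity
  have ns : ∀ (c : ℝ) (v : E) (d : ℝ), 0 ≤ c → ‖v‖ ≤ d → ‖c • v‖ ≤ c * d := by
    intro c v d hc hv
    rw [norm_smul, Real.norm_of_nonneg hc]; gcongr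
  obtain ⟨D, hD⟩ : ∃ D, D = DD K L := ⟨_, rfl⟩
  have hD0 : 0 ≤ D := by rw [hD]; unfold DD; positivity
  obtain ⟨k2, hk2⟩ : ∃ k, k = g (y + (h/2) • a) := ⟨_, rfl⟩
  obtain ⟨k3, hk3⟩ : ∃ k, k = g (y + (h/2) • k2) := ⟨_, rfl⟩
  obtain ⟨k4, hk4⟩ : ∃ k, k = g (y + h • k3) := ⟨_, rfl⟩
  have hrk : rk g h y = y + (h/6) • (a + (2:ℝ) • k2 + (2:ℝ) • k3 + k4) := by
    rw [hk4, hk3, hk2, ha]; rfl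
  -- second stage
  have x2 : ‖k2 - (a + (h/2) • A a + (h^2/4) • B a a + (h^3/8) • C a a a)‖ ≤ D * h^4 := by
    have := X3 hK0 hT hL (L := L) (e := 0) (s := h) h0 h1 (a₁ := (1/2:ℝ) • a) (a₂ := 0) (a₃ := 0)
      (v := (h/2) • a) ((ns _ _ _ (by norm_num) na).trans (by linarith)) (by simpa) (by simpa)
      (by
        have : (h / 2) • a - (h • (1/2:ℝ) • a + h ^ 2 • (0:E) + h ^ 3 • (0:E)) = 0 := by module
        rw [this]; simp)
    rw [← hk2, ← ha, ← hD] at this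
    convert this using 1
    · congr 1
      simp only [map_smul, smul_apply, map_zero, zero_apply]
      module
    · ring
  have x3 : ‖k3 - (a + (h/2) • A a + (h^2/4) • (A (A a) + B a a)
      + (h^3/8) • (A (B a a) + B a (A a) + B (A a) a + C a a a))‖ ≤ (K * (D + L) + D) * h^4 := by
    have := X3 hK0 hT hL (L := L) (e := D + L) (s := h) h0 h1 (a₁ := (1/2:ℝ) • a)
      (a₂ := (1/4:ℝ) • A a) (a₃ := (1/8:ℝ) • B a a)
      (v := (h/2) • k2) ((ns _ _ _ (by norm_num) na).trans (by linarith))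
      ((ns _ _ _ (by norm_num) nAa).trans (by nlinarith))
      ((ns _ _ _ (by norm_num) nBaa).trans (by nlinarith))
      (by
        have : (h / 2) • k2 - (h • (1/2:ℝ) • a + h ^ 2 • (1/4:ℝ) • A a + h ^ 3 • (1/8:ℝ) • B a a)
           = (h/2) • (k2 - (a + (h/2) • A a + (h^2/4) • B a a + (h^3/8) • C a a a))
             + (h^4/16) • C a a a := by module
        rw [this]
        refine (norm_add_le _ _).trans ((add_le_add (ns _ _ _ (by positivity) x2) 
          (ns _ _ _ (by positivity) nCaaa)).trans ?_)
        have z1 : 0 ≤ D * h^4 := by positivity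
        have z2 : 0 ≤ L * h^4 := by positivity
        nlinarith)
    rw [← hk3, ← ha, ← hD] at this
    convert this using 1
    congr 1
    simp only [map_smul, smul_apply]
    module
  have x4 : ‖k4 - (a + h • A a + (h^2/2) • (A (A a)) + h^2 • B a a
      + h^3 • ((1/4:ℝ) • (A (A (A a)) + A (B a a)) + (1/2:ℝ) • (B a (A a) + B (A a) a) + C a a a))‖
      ≤ (K * ((K * (D + L) + D) + L) + D) * h^4 := by
    have := X3 hK0 hT hL (L := L) (e := (K * (D + L) + D) + L) (s := h) h0 h1 (a₁ := a)
      (a₂ := (1/2:ℝ) • A a) (a₃ := (1/4:ℝ) • A (A a) + (1/4:ℝ) • B a a)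
      (v := h • k3) (na.trans (by linarith))
      ((ns _ _ _ (by norm_num) nAa).trans (by nlinarith))
      ((norm_add_le _ _).trans ((add_le_add (ns _ _ _ (by norm_num) nAAa) 
         (ns _ _ _ (by norm_num) nBaa)).trans (by nlinarith)))
      (by
        have : h • k3 - (h • a + h ^ 2 • (1/2:ℝ) • A a
             + h ^ 3 • ((1/4:ℝ) • A (A a) + (1/4:ℝ) • B a a))
           = h • (k3 - (a + (h/2) • A a + (h^2/4) • (A (A a) + B a a)
      + (h^3/8) • (A (B a a) + B a (A a) + B (A a) a + C a a a)))
             + (h^4/8) • (A (B a a) + B a (A a) + B (A a) a + C a a a) := by module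
        rw [this]
        have n4 := (norm_add_le _ _).trans (add_le_add ((norm_add_le _ _).trans (add_le_add
          ((norm_add_le _ _).trans (add_le_add nABaa nBaAa)) nBAaa)) nCaaa)
        refine (norm_add_le _ _).trans ((add_le_add (ns _ _ _ (by positivity) x3) 
          (ns _ _ _ (by positivity) n4)).trans ?_)
        have z1 : 0 ≤ (K * (D + L) + D) * h^4 := by positivity
        have z2 : 0 ≤ L * h^4 := by positivity
        nlinarith)
    rw [← hk4, ← ha, ← hD] at this
    convert this using 1
    congr 1
    simp only [map_smul, smul_apply, map_add, add_apply]
    module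
  -- exact solution
  obtain ⟨a3, ha3⟩ : ∃ v, v = (1/6:ℝ) • A (A a) + (1/3:ℝ) • B a a := ⟨_, rfl⟩
  obtain ⟨a4, ha4⟩ : ∃ v, v = (1/24:ℝ) • A (A (A a)) + (1/12:ℝ) • A (B a a)
    + (1/8:ℝ) • (B a (A a) + B (A a) a) + (1/4:ℝ) • C a a a := ⟨_, rfl⟩
  have na3 : ‖a3‖ ≤ L := by
    rw [ha3]
    exact ((norm_add_le _ _).trans ((add_le_add (ns _ _ _ (by norm_num) nAAa) 
         (ns _ _ _ (by norm_num) nBaa)).trans (by nlinarith)))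
  have na4 : ‖a4‖ ≤ L := by
    rw [ha4]
    have nn := (norm_add_le _ _).trans (add_le_add nBaAa nBAaa)
    exact (norm_add_le _ _).trans ((add_le_add ((norm_add_le _ _).trans (add_le_add
          ((norm_add_le _ _).trans (add_le_add (ns (1/24) _ _ (by norm_num) nAAAa)
            (ns (1/12) _ _ (by norm_num) nABaa))) (ns (1/8) _ _ (by norm_num) nn)))
            (ns (1/4) _ _ (by norm_num) nCaaa)).trans (by linarith))
  have hgl : LipschitzWith ⟨K, hK0⟩ g :=
    LipschitzWith.of_dist_le_mul (fun p q => by rw [dist_eq_norm, dist_eq_norm]; exact hL p q)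
  let q : ℝ → E := fun s => y + (s • a + s^2 • ((1/2:ℝ) • A a) + s^3 • a3 + s^4 • a4)
  let q' : ℝ → E := fun s => (a + (2*s) • ((1/2:ℝ) • A a) + (3*s^2) • a3 + (4*s^3) • a4)
  have hq : ∀ s, HasDerivAt q (q' s) s := fun s => (polyDeriv _ _ _ _ s).const_add y
  have gr := dist_le_of_approx_trajectories_ODE (v := fun _ => g) (K := ⟨K, hK0⟩) (f := u) (g := q)
    (f' := fun s => g (u s)) (g' := q') (a := 0) (b := h) (εf := 0) (εg := (K * L + D) * h^4) (δ := 0)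
    (fun _ => hgl) (fun s hs => (hu s hs).continuousAt.continuousWithinAt)
    (fun s hs => (hu s ⟨hs.1, hs.2.le⟩).hasDerivWithinAt)
    (fun s hs => by simp) (fun s hs => (hq s).continuousAt.continuousWithinAt)
    (fun s hs => (hq s).hasDerivWithinAt)
    (by
      intro s hs
      have hs0 := hs.1
      have := X3 hK0 hT hL (L := L) (e := L) (s := s) hs.1 (hs.2.le.trans h1) (a₁ := a)
        (a₂ := (1/2:ℝ) • A a) (a₃ := a3)
        (v := s • a + s^2 • ((1/2:ℝ) • A a) + s^3 • a3 + s^4 • a4) (na.trans (by linarith))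
        ((ns _ _ _ (by norm_num) nAa).trans (by nlinarith)) na3
        (by
          rw [add_sub_cancel_left, mul_comm]
          exact ns _ _ _ (by positivity) na4)
      rw [dist_comm, dist_eq_norm]
      rw [← hD, ← ha] at this
      have e : q' s = a + s • A a + s ^ 2 • (A ((1 / 2:ℝ) • A a) + B a a) +
          s ^ 3 • (A a3 + B a ((1 / 2:ℝ) • A a) + B ((1 / 2:ℝ) • A a) a + C a a a) := by
        simp only [q']
        rw [ha3, ha4]
        simp only [map_smul, smul_apply, map_add, add_apply]
        module
      rw [e]
      refine this.trans ?_
      have := hs.2.le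
      gcongr)
    (by simp [q, hu0]) h ⟨h0, le_rfl⟩
  have gr2 : ‖u h - q h‖ ≤ (K * L + D) * Real.exp K * h^5 := by
    rw [dist_eq_norm] at gr
    refine gr.trans ?_
    have hKne : K ≠ 0 := by linarith
    change gronwallBound 0 K (0 + (K * L + D) * h^4) (h - 0) ≤ _
    rw [gronwallBound_of_K_ne_0 hKne]
    simp only [zero_mul, zero_add, sub_zero]
    have t1 : Real.exp (K*h) - 1 ≤ K * h * Real.exp K := by
      have q1 := Real.add_one_le_exp (-(K*h))
      have q2 := Real.exp_pos (K*h)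
      have q3 : Real.exp (K*h) * Real.exp (-(K*h)) = 1 := by rw [← Real.exp_add]; simp
      have q4 : Real.exp (K*h) ≤ Real.exp K := Real.exp_le_exp.2 (by nlinarith)
      have q5 : 0 ≤ K * h := by positivity
      nlinarith [mul_le_mul_of_nonneg_left q4 q5]
    calc (K * L + D) * h^4 / K * (Real.exp (K*h) - 1) 
        ≤ (K * L + D) * h^4 / K * (K * h * Real.exp K) := by gcongr
      _ = _ := by field_simp
  have key : u h - rk g h y = (u h - q h) - (h/6) • (
      (2:ℝ) • (k2 - (a + (h/2) • A a + (h^2/4) • B a a + (h^3/8) • C a a a))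
      + (2:ℝ) • (k3 - (a + (h/2) • A a + (h^2/4) • (A (A a) + B a a)
      + (h^3/8) • (A (B a a) + B a (A a) + B (A a) a + C a a a)))
      + (k4 - (a + h • A a + (h^2/2) • (A (A a)) + h^2 • B a a
      + h^3 • ((1/4:ℝ) • (A (A (A a)) + A (B a a)) + (1/2:ℝ) • (B a (A a) + B (A a) a) + C a a a)))) := by
    rw [hrk]
    simp only [q]
    rw [ha3, ha4]
    module
  rw [key]
  have S := (norm_add_le _ _).trans (add_le_add ((norm_add_le _ _).trans (add_le_add
    (ns 2 _ _ (by norm_num) x2) (ns 2 _ _ (by norm_num) x3))) x4)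
  refine (norm_sub_le _ _).trans ((add_le_add gr2 (ns (h/6) _ _ (by positivity) S)).trans ?_)
  unfold errC
  simp only
  rw [← hLL, ← hD]
  have z : 0 ≤ (2 * D + 2 * (K * (D + L) + D) + (K * ((K * (D + L) + D) + L) + D)) * h^5 := by positivity
  nlinarith

theorem global_err {g : E → E} {K : ℝ} (hK : 1 ≤ K)
    (hT : ∀ y, ∃ A B C, TB g K y A B C)
    (hL : ∀ u v, ‖g u - g v‖ ≤ K * ‖u - v‖) (hbd : ∀ u, ‖g u‖ ≤ K)
    (a b : ℝ) (hab : a ≤ b) (y : ℝ → E) (hy : ∀ s ∈ Set.Icc a b, HasDerivAt y (g (y s)) s)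
    (M : ℕ) (hM : 1 ≤ M) (h : ℝ) (hh : h = (b - a) / M) (h1 : h ≤ 1) (Q : ℕ → E) (Q0 : Q 0 = y a)
    (hQ : ∀ s < M, Q (s+1) = rk g h (Q s)) :
    ‖y b - Q M‖ ≤ ((b - a) * errC K * Real.exp (3 * K^4 * (b - a))) * h^4 := by
  have hM' : (0:ℝ) < M := by exact_mod_cast hM
  have h0 : 0 ≤ h := by rw [hh]; have := sub_nonneg.2 hab; positivity
  have hMh : M * h = b - a := by rw [hh]; field_simp
  have hK0 : 0 ≤ K := by linarith
  have hLE : 0 ≤ errC K := by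
    unfold errC DD; simp only; positivity
  have ind : ∀ s : ℕ, s ≤ M → ‖y (a + s * h) - Q s‖ ≤ s * (errC K * h^5) * (1 + h * (3*K^4))^s := by
    intro s
    induction s with
    | zero => intro _; simp [Q0]
    | succ s ih =>
      intro hs
      have ih := ih (by omega)
      rw [hQ s (by omega)]
      obtain ⟨A, B, C, hABC⟩ := hT (y (a + s * h))
      have hsM : ((s:ℝ) + 1) * h ≤ b - a := by
        rw [← hMh]; gcongr; exact_mod_cast hs
      have hs0 : 0 ≤ (s:ℝ) * h := by positivity
      have loc := local_err hK hABC hL hbd h0 h1 (fun r => y (a + s * h + r))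
        (by
          intro r hr
          have := hy (a + s*h + r) ⟨by linarith [hr.1], by linarith [hr.2]⟩
          exact HasDerivAt.comp_const_add (a + s * h) r this) (by simp)
      have lip := rk_lip hK hL h0 h1 (y (a + s * h)) (Q s)
      have e : y (a + ((s+1:ℕ):ℝ) * h) = y (a + s * h + h) := by
        congr 1; push_cast; ring
      rw [e]
      refine (norm_sub_le_norm_sub_add_norm_sub _ (rk g h (y (a + s * h))) _).trans
        ((add_le_add loc lip).trans ?_)
      have w : 0 ≤ h * (3 * K^4) := by positivity
      have w1 : 1 ≤ (1 + h * (3*K^4))^(s+1) := one_le_pow₀ (by linarith)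
      have w2 : 0 ≤ errC K * h^5 := by positivity
      have w3 := mul_le_mul_of_nonneg_left ih (by linarith : 0 ≤ 1 + h * (3 * K^4))
      have w4 := mul_le_mul_of_nonneg_left w1 w2
      push_cast
      calc _ ≤ errC K * h^5 * (1 + h * (3*K^4))^(s+1) + (1 + h * (3 * K^4)) * (s * (errC K * h^5) * (1 + h * (3*K^4))^s) := by linarith
        _ = _ := by ring
  have fin := ind M le_rfl
  rw [hMh] at fin
  rw [add_sub_cancel] at fin
  refine fin.trans ?_
  have ex : (1 + h * (3*K^4))^M ≤ Real.exp (3 * K^4 * (b - a)) := by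
    have := Real.add_one_le_exp (h * (3*K^4))
    calc (1 + h * (3*K^4))^M ≤ (Real.exp (h * (3*K^4)))^M := by
          gcongr; linarith
      _ = _ := by rw [← Real.exp_nat_mul, ← hMh]; congr 1; ring
  calc _ ≤ M * (errC K * h^5) * Real.exp (3 * K^4 * (b - a)) := by gcongr
    _ = (M * h) * errC K * Real.exp (3 * K^4 * (b - a)) * h^4 := by ring
    _ = _ := by rw [hMh]
end

theorem TB_of {X : Type*} [NormedAddCommGroup X] [NormedSpace ℝ X] (F : X × ℝ → X) (K : ℝ)
    (hK : 0 ≤ K) (hF : ContDiff ℝ 4 F)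
    (hb : ∀ i : ℕ, i ≤ 4 → ∀ z : X × ℝ, ‖iteratedFDeriv ℝ i F z‖ ≤ K) (y : X × ℝ) :
    ∃ A B C, TB (fun z => (F z, (1:ℝ))) K y A B C := by
  have d1 : ∀ z, ‖fderiv ℝ F z‖ ≤ K := fun z => by
    rw [← norm_iteratedFDeriv_one]; exact hb 1 (by norm_num) z
  have d2 : ∀ z, ‖fderiv ℝ (fderiv ℝ F) z‖ ≤ K := fun z => by
    rw [← norm_iteratedFDeriv_one, norm_iteratedFDeriv_fderiv]; exact hb 2 (by norm_num) z
  have d3 : ∀ z, ‖fderiv ℝ (fderiv ℝ (fderiv ℝ F)) z‖ ≤ K := fun z => by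
    rw [← norm_iteratedFDeriv_one, norm_iteratedFDeriv_fderiv, norm_iteratedFDeriv_fderiv]
    exact hb 3 (by norm_num) z
  have d4 : ∀ z, ‖fderiv ℝ (fderiv ℝ (fderiv ℝ (fderiv ℝ F))) z‖ ≤ K := fun z => by
    rw [← norm_iteratedFDeriv_one, norm_iteratedFDeriv_fderiv, norm_iteratedFDeriv_fderiv,
      norm_iteratedFDeriv_fderiv]
    exact hb 4 (by norm_num) z
  obtain ⟨A, hA⟩ : ∃ A, A = fderiv ℝ F y := ⟨_, rfl⟩
  obtain ⟨B, hB⟩ : ∃ A, A = fderiv ℝ (fderiv ℝ F) y := ⟨_, rfl⟩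
  obtain ⟨C, hC⟩ : ∃ A, A = fderiv ℝ (fderiv ℝ (fderiv ℝ F)) y := ⟨_, rfl⟩
  have T := T3 F K hK hF d4 y
  have nA := d1 y
  have nB := d2 y
  have nC := d3 y
  rw [← hA] at nA
  rw [← hB] at nB
  rw [← hC] at nC
  rw [← hA, ← hB, ← hC] at T
  let i : X →L[ℝ] X × ℝ := ContinuousLinearMap.inl ℝ X ℝ
  let i1 := ContinuousLinearMap.compL ℝ (X × ℝ) X (X × ℝ) i
  let i2 := ContinuousLinearMap.compL ℝ (X × ℝ) _ _ i1
  have hi : ∀ x, ‖i x‖ = ‖x‖ := fun x => by simp [i, Prod.norm_def]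
  refine ⟨i.comp A, (1/2:ℝ) • i1.comp B, (1/6:ℝ) • i2.comp C, ?_, ?_, ?_, ?_⟩
  · intro u
    change ‖i (A u)‖ ≤ _
    rw [hi]
    exact (A.le_opNorm u).trans (by gcongr)
  · intro u v
    change ‖(1/2:ℝ) • i (B u v)‖ ≤ _
    rw [norm_smul, hi]
    have h1 : ‖B u v‖ ≤ K * ‖u‖ * ‖v‖ := (B.le_opNorm₂ u v).trans (by gcongr)
    have := norm_nonneg (B u v)
    norm_num
    linarith
  · intro u v w
    change ‖(1/6:ℝ) • i (C u v w)‖ ≤ _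
    rw [norm_smul, hi]
    have h1 : ‖C u v w‖ ≤ K * ‖u‖ * ‖v‖ * ‖w‖ :=
      ((C u v).le_opNorm w).trans (by gcongr; exact (C.le_opNorm₂ u v).trans (by gcongr))
    have := norm_nonneg (C u v w)
    norm_num
    linarith
  · intro v
    refine le_trans (le_of_eq ?_) (T v)
    rw [← hi]
    congr 1
    change (F (y+v), (1:ℝ)) - ((F y, (1:ℝ)) + i (A v) + (1/2:ℝ) • i (B v v) + (1/6:ℝ) • i (C v v v)) = _
    simp [i]

/-- The `M`-stage recursive classical four-stage Runge–Kutta scheme is fourth-order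
accurate: if `F : ℝⁿ × ℝ → ℝⁿ` is `C⁴` with all derivatives up to order four bounded,
and `Φ` solves `Φ' = F(Φ, ·)` on `[a, b]`, then the iterates `P M` with step
`h = (b − a)/M` started from `Φ(a)` satisfy, for some `C > 0` and all large `M`,
`‖Φ(b) − P M M‖ ≤ C·((b − a)/M)⁴`. -/
theorem recursive_rk4_fourth_order
    {n : ℕ} (F : (Fin n → ℝ) × ℝ → Fin n → ℝ) (Φ : ℝ → Fin n → ℝ) (a b : ℝ)
    (hab : a ≤ b)
    (hF : ContDiff ℝ 4 F)
    (hFbdd : ∃ B : ℝ, ∀ i : ℕ, i ≤ 4 → ∀ z : (Fin n → ℝ) × ℝ,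
      ‖iteratedFDeriv ℝ i F z‖ ≤ B)
    (hODE : ∀ s ∈ Set.Icc a b, HasDerivAt Φ (F (Φ s, s)) s)
    (P : ℕ → ℕ → Fin n → ℝ)
    (hP0 : ∀ M : ℕ, 1 ≤ M → P M 0 = Φ a)
    (hPrec : ∀ M : ℕ, 1 ≤ M → ∀ s < M,
      let h := (b - a) / M
      let τ := fun j : ℕ => a + j * h
      let K₁ := F (P M s, τ s)
      let K₂ := F (P M s + (h / 2) • K₁, τ s + h / 2)
      let K₃ := F (P M s + (h / 2) • K₂, τ s + h / 2)
      let K₄ := F (P M s + h • K₃, τ (s + 1))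
      P M (s + 1) = P M s + (h / 6) • (K₁ + 2 • K₂ + 2 • K₃ + K₄)) :
    ∃ C > (0 : ℝ), ∃ M₀ : ℕ, 1 ≤ M₀ ∧ ∀ M : ℕ, M₀ ≤ M →
      ‖Φ b - P M M‖ ≤ C * ((b - a) / M) ^ 4 := by
  obtain ⟨B, hB⟩ := hFbdd
  obtain ⟨K, hK⟩ : ∃ K, K = max B 1 := ⟨_, rfl⟩
  have hK1 : 1 ≤ K := hK ▸ le_max_right _ _
  have hK0 : 0 ≤ K := by linarith
  have hb : ∀ i : ℕ, i ≤ 4 → ∀ z : (Fin n → ℝ) × ℝ, ‖iteratedFDeriv ℝ i F z‖ ≤ K :=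
    fun i hi z => (hB i hi z).trans (hK ▸ le_max_left _ _)
  let g : (Fin n → ℝ) × ℝ → (Fin n → ℝ) × ℝ := fun z => (F z, (1:ℝ))
  have hT : ∀ y, ∃ A B C, TB g K y A B C := TB_of F K hK0 hF hb
  have hbd : ∀ u, ‖g u‖ ≤ K := fun u => by
    have := hb 0 (by norm_num) u
    rw [norm_iteratedFDeriv_zero] at this
    simp only [g, Prod.norm_def]
    exact max_le this (by simpa using hK1)
  have hL : ∀ u v, ‖g u - g v‖ ≤ K * ‖u - v‖ := fun u v => by
    have := T0 F K (hF.differentiable (by norm_num)) (fun z => by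
      rw [← norm_iteratedFDeriv_one]; exact hb 1 (by norm_num) z) v (u - v)
    rw [add_sub_cancel] at this
    simp only [g]
    rw [Prod.mk_sub_mk, sub_self, Prod.norm_def]
    exact max_le this (by simp; positivity)
  let y : ℝ → (Fin n → ℝ) × ℝ := fun s => (Φ s, s)
  have hy : ∀ s ∈ Set.Icc a b, HasDerivAt y (g (y s)) s := fun s hs =>
    (hODE s hs).prodMk (hasDerivAt_id s)
  obtain ⟨M₀, hM₀⟩ := exists_nat_ge (max (b - a) 1)
  have hba := sub_nonneg.2 hab
  refine ⟨|(b - a) * errC K * Real.exp (3 * K^4 * (b - a))| + 1, by positivity, M₀,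
    by exact_mod_cast (le_max_right (b - a) 1).trans hM₀, ?_⟩
  intro M hM
  have hMr : max (b - a) 1 ≤ (M:ℝ) := hM₀.trans (by exact_mod_cast hM)
  have hM1 : (1:ℝ) ≤ M := (le_max_right _ _).trans hMr
  have hM1' : 1 ≤ M := by exact_mod_cast hM1
  have h1 : (b - a) / M ≤ 1 := div_le_one_of_le₀ ((le_max_left _ _).trans hMr) (by linarith)
  have G := global_err hK1 hT hL hbd a b hab y hy M hM1' _ rfl h1
    (fun s => (P M s, a + s * ((b - a) / M))) (by simp [y, hP0 M hM1'])
    (by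
      intro s hs
      have := hPrec M hM1' s hs
      simp only at this
      simp only [this]
      unfold rk
      have e1 : a + ((s+1:ℕ):ℝ) * ((b - a) / M) = a + s * ((b - a) / M) + (b - a) / M := by
        push_cast; ring
      simp only [g, Prod.smul_mk, Prod.mk_add_mk, smul_eq_mul, mul_one, e1]
      refine Prod.ext ?_ ?_
      · simp only [← Nat.cast_smul_eq_nsmul ℝ, Nat.cast_ofNat]
      · simp only
        ring)
  have G2 := (norm_fst_le _).trans G
  refine (show ‖Φ b - P M M‖ ≤ _ from G2).trans ?_
  gcongr
  exact (le_abs_self _).trans (by linarith)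
end
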